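/- arXiv:1807.06473 — 2 statements merged into one kernel-verified Lean document; each statement's English description precedes it below -/
import Mathlib

section
/- Let α ∈ (0,1) and set κ = 1/(1 + exp(1 − 1/α)). Let R, M : ℕ → ℕ be sequences, and for t ≥ 2 write N_t = t, L_t = t − R_t, and p_t = M_t / t. Assume R_2 = 1, M_2 = 0, and for every t ≥ 2: R_{t+1} ∈ {R_t, R_t + 1}; M_{t+1} ∈ {M_t, M_t + 1}; if (R_t : ℝ) > κ·t and R_{t+1} = R_t + 1 then M_{t+1} = M_t + 1; and if (L_t : ℝ) > κ·t and R_{t+1} = R_t then M_{t+1} = M_t + 1. Then for every T ≥ 2: min{L_T, R_T} / T ≥ (1 − p_T)/(exp((1 − α)/α) + 1) − 1/T. In particular, whenever (1 − p_T) > (1 + exp((1 − α)/α))/T, one has min{L_T, R_T} ≥ T/K for K = (1 + exp((1 − α)/α)) / ((1 − p_T) − (1 + exp((1 − α)/α))/T). -/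
/-- Theorem 1 (Partition bound) of "Contextual Memory Trees", abstracted to the
sequence of counts at a single internal node. -/
theorem cmt_partition_bound
    (α : ℝ) (hα : 0 < α ∧ α < 1)
    (κ : ℝ) (hκ : κ = 1 / (1 + Real.exp (1 - 1 / α)))
    (R M : ℕ → ℕ)
    (hR2 : R 2 = 1) (hM2 : M 2 = 0)
    (hRstep : ∀ t : ℕ, 2 ≤ t → R (t + 1) = R t ∨ R (t + 1) = R t + 1)
    (hMstep : ∀ t : ℕ, 2 ≤ t → M (t + 1) = M t ∨ M (t + 1) = M t + 1)
    (hmisR : ∀ t : ℕ, 2 ≤ t → (R t : ℝ) > κ * t → R (t + 1) = R t + 1 → M (t + 1) = M t + 1)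
    (hmisL : ∀ t : ℕ, 2 ≤ t → ((t : ℝ) - R t) > κ * t → R (t + 1) = R t → M (t + 1) = M t + 1) :
    ∀ T : ℕ, 2 ≤ T →
      min ((T : ℝ) - R T) (R T) / T
        ≥ (1 - (M T : ℝ) / T) / (Real.exp ((1 - α) / α) + 1) - 1 / T ∧
      ((1 - (M T : ℝ) / T) > (1 + Real.exp ((1 - α) / α)) / T →
        min ((T : ℝ) - R T) (R T)
          ≥ (T : ℝ) /
            ((1 + Real.exp ((1 - α) / α)) /
              ((1 - (M T : ℝ) / T) - (1 + Real.exp ((1 - α) / α)) / T))) := by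
  have hA : 0 < 1 + Real.exp ((1 - α) / α) := by positivity
  have hκ' : κ = 1 - 1 / (1 + Real.exp ((1 - α) / α)) := by
    have h : 1 - 1 / α = -((1 - α) / α) := by
      have := hα.1.ne'
      field_simp
      ring
    rw [hκ, h, Real.exp_neg]
    have := Real.exp_pos ((1 - α) / α)
    field_simp
    ring
  have hA1 : 1 < 1 + Real.exp ((1 - α) / α) := by linarith [Real.exp_pos ((1 - α) / α)]
  rw [add_comm (Real.exp ((1 - α) / α)) 1]
  generalize 1 + Real.exp ((1 - α) / α) = A at *
  have hc0 : 0 < 1 / A := by positivity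
  have hc1 : 1 / A < 1 := (div_lt_one hA).2 hA1
  have key : ∀ T : ℕ, 2 ≤ T → 1 / A * ((T : ℝ) - M T) - 1 ≤ R T ∧
      1 / A * ((T : ℝ) - M T) - 1 ≤ (T : ℝ) - R T := by
    generalize 1 / A = c at *
    intro T hT
    induction T, hT using Nat.le_induction with
    | base =>
      rw [hR2, hM2]
      push_cast
      constructor <;> linarith
    | succ t ht ih =>
      obtain ⟨ihR, ihL⟩ := ih
      have hcM : 0 ≤ c * (M t : ℝ) := by positivity
      rcases hMstep t ht with hM | hM
      · rcases hRstep t ht with hR | hR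
        · have hL : (t : ℝ) - R t ≤ κ * t := by
            by_contra! h
            have := hmisL t ht h hR
            omega
          rw [hM, hR]
          subst hκ'
          push_cast
          constructor <;> nlinarith
        · have hr : (R t : ℝ) ≤ κ * t := by
            by_contra! h
            have := hmisR t ht h hR
            omega
          rw [hM, hR]
          subst hκ'
          push_cast
          constructor <;> nlinarith
      · rw [hM]
        rcases hRstep t ht with hR | hR <;> rw [hR] <;> push_cast <;>
          constructor <;> nlinarith
  intro T hT
  have hT0 : (0 : ℝ) < T := by
    exact_mod_cast (by omega : 0 < T)
  have hmin : 1 / A * ((T : ℝ) - M T) - 1 ≤ min ((T : ℝ) - R T) (R T) :=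
    le_min (key T hT).2 (key T hT).1
  refine ⟨?_, fun _ => ?_⟩
  · rw [ge_iff_le, le_div_iff₀ hT0]
    refine le_of_eq_of_le ?_ hmin
    field_simp
  · refine le_of_eq_of_le ?_ hmin
    rw [div_div_eq_mul_div]
    field_simp
end

section
/- Let κ ∈ (0,1) be a real number and let R, M : ℕ → ℕ satisfy R_2 ≤ 1 and, for every t ≥ 2: R_{t+1} ∈ {R_t, R_t + 1}; M_{t+1} ∈ {M_t, M_t + 1}; and if (R_t : ℝ) > κ·t and R_{t+1} = R_t + 1 then M_{t+1} = M_t + 1. Then for every t ≥ 2, (R_t : ℝ) ≤ κ·t + (1 − κ)·(M_t + 1); equivalently, R_t ≤ (1 − p_t)·κ·t + (1 − κ) + p_t·t, where p_t = M_t / t. -/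
/-- The inductive invariant in the proof of Theorem 1 (Partition bound) of
"Contextual Memory Trees". -/
theorem cmt_partition_invariant
    (κ : ℝ) (hκ : 0 < κ ∧ κ < 1)
    (R M : ℕ → ℕ)
    (hR2 : R 2 ≤ 1)
    (hRstep : ∀ t ≥ 2, R (t + 1) = R t ∨ R (t + 1) = R t + 1)
    (hMstep : ∀ t ≥ 2, M (t + 1) = M t ∨ M (t + 1) = M t + 1)
    (hmis : ∀ t ≥ 2, (R t : ℝ) > κ * t → R (t + 1) = R t + 1 → M (t + 1) = M t + 1) :
    ∀ t : ℕ, 2 ≤ t →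
      (R t : ℝ) ≤ κ * t + (1 - κ) * (M t + 1) ∧
      (R t : ℝ) ≤ (1 - (M t : ℝ) / t) * κ * t + (1 - κ) + ((M t : ℝ) / t) * t := by
  have invariant : ∀ t : ℕ, 2 ≤ t → (R t : ℝ) ≤ κ * t + (1 - κ) * (M t + 1) := by
    obtain ⟨hκ0, hκ1⟩ := hκ
    have nonneg (n : ℕ) : 0 ≤ (1 - κ) * (n : ℝ) :=
      mul_nonneg (by linarith) n.cast_nonneg
    intro t ht
    induction t, ht using Nat.le_induction with
    | base =>
      have h : (R 2 : ℝ) ≤ 1 := by exact_mod_cast hR2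
      push_cast
      linarith [nonneg (M 2)]
    | succ t ht ih =>
      rcases hRstep t ht with hR | hR
      · rcases hMstep t ht with hM | hM <;> rw [hR, hM] <;> push_cast <;> linarith
      · by_cases hlarge : (R t : ℝ) > κ * t
        · rw [hR, hmis t ht hlarge hR]
          push_cast
          linarith
        · rw [hR]
          push_cast
          linarith [nonneg (M (t + 1))]
  intro t ht
  refine ⟨invariant t ht, (invariant t ht).trans_eq ?_⟩
  have ht0 : (t : ℝ) ≠ 0 := Nat.cast_ne_zero.mpr (by omega)
  field_simp
  ring
end
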